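/- arXiv:1601.02453 — 2 statements merged into one kernel-verified Lean document; each statement's English description precedes it below -/
import Mathlib

section
/- There exists a strategy for Ann that allows her to win the non-repetitive game of any length on an alphabet of 7 letters when Ann moves first. Precisely: there exists a function s : List (Fin 7) → Fin 7 (Ann's strategy) such that for every function b : List (Fin 7) → Fin 7 (Ben's moves) and every n : ℕ, the word w_n defined by w_0 = [] and w_{k+1} = w_k ++ [s w_k] if k is even, w_{k+1} = w_k ++ [b w_k] if k is odd, contains no non-trivial square, i.e., there is no word u with u.length ≥ 2 such that u ++ u is a factor (contiguous sublist) of w_n. -/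
/-- The word built in the non-repetitive game where Ann (strategy `s`) moves at
even steps and Ben (moves given by `b`) moves at odd steps. -/
def gameWordAnnFirst (s b : List (Fin 7) → Fin 7) : ℕ → List (Fin 7)
  | 0 => []
  | k + 1 =>
      gameWordAnnFirst s b k ++
        [if k % 2 = 0 then s (gameWordAnnFirst s b k) else b (gameWordAnnFirst s b k)]

namespace NRG

abbrev Wd := List (Fin 7)

/-- `w` has a square of period `p` ending at position `L`. -/
def SqEnd (w : Wd) (L p : ℕ) : Prop :=
  2 * p ≤ L ∧ L ≤ w.length ∧ ∀ i < p, w[L - p + i]? = w[L - 2 * p + i]?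

def Good (w : Wd) : Prop := ∀ L p, 2 ≤ p → ¬ SqEnd w L p

lemma SqEnd.take {w : Wd} {L p m : ℕ} (h : SqEnd w L p) (hm : L ≤ m) : SqEnd (w.take m) L p := by
  obtain ⟨h1, h2, h3⟩ := h
  refine ⟨h1, by simp; omega, fun i hi => ?_⟩
  rw [List.getElem?_take_of_lt (by omega), List.getElem?_take_of_lt (by omega)]
  exact h3 i hi

lemma SqEnd.of_take {w : Wd} {L p m : ℕ} (h : SqEnd (w.take m) L p) : SqEnd w L p := by
  obtain ⟨h1, h2, h3⟩ := h
  simp only [List.length_take, le_inf_iff] at h2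
  refine ⟨h1, h2.2, fun i hi => ?_⟩
  have := h3 i hi
  rwa [List.getElem?_take_of_lt (by omega), List.getElem?_take_of_lt (by omega)] at this

lemma Good.take {w : Wd} (h : Good w) (m : ℕ) : Good (w.take m) :=
  fun L p hp hs => h L p hp hs.of_take

lemma sqEnd_of_factor (u x y : Wd) :
    SqEnd (x ++ (u ++ u) ++ y) (x.length + 2 * u.length) u.length := by
  refine ⟨by omega, by simp; omega, fun i hi => ?_⟩
  have e1 : x.length + 2 * u.length - u.length + i = x.length + (u.length + i) := by omega
  have e2 : x.length + 2 * u.length - 2 * u.length + i = x.length + i := by omega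
  rw [e1, e2, List.append_assoc, List.append_assoc]
  rw [List.getElem?_append_right (i := x.length + (u.length + i)) (by omega),
    List.getElem?_append_right (i := x.length + i) (by omega)]
  rw [show x.length + (u.length + i) - x.length = u.length + i by omega,
    show x.length + i - x.length = i by omega]
  rw [List.getElem?_append_right (i := u.length + i) (by omega),
    show u.length + i - u.length = i by omega, List.getElem?_append_left hi,
    List.getElem?_append_left hi]

/-- A square together with the prefix determines the word up to `L`. -/
lemma sqEnd_det {w v : Wd} {L p m : ℕ} (hw : SqEnd w L p) (hv : SqEnd v L p)
    (hm : L - p ≤ m) (h : w.take m = v.take m) : w.take L = v.take L := by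
  obtain ⟨h1, h2, h3⟩ := hw
  obtain ⟨_, h2', h3'⟩ := hv
  have key : ∀ i, i < m → w[i]? = v[i]? := fun i hi => by
    rw [← List.getElem?_take_of_lt hi, h, List.getElem?_take_of_lt hi]
  apply List.ext_getElem?
  intro i
  by_cases hi : i < L
  · rw [List.getElem?_take_of_lt hi, List.getElem?_take_of_lt hi]
    by_cases hi2 : i < m
    · exact key i hi2
    · have a := h3 (i - (L - p)) (by omega)
      have a' := h3' (i - (L - p)) (by omega)
      rw [show L - p + (i - (L - p)) = i by omega] at a a'
      rw [a, a']
      exact key _ (by omega)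
  · rw [List.getElem?_eq_none (by simp; omega), List.getElem?_eq_none (by simp; omega)]

def ext (b : Wd → Fin 7) (x : Wd × Fin 7) : Wd := x.1 ++ [x.2] ++ [b (x.1 ++ [x.2])]

open Classical in
noncomputable def cand (b : Wd → Fin 7) (S : Finset Wd) : Finset Wd :=
  (S ×ˢ (Finset.univ : Finset (Fin 7))).image (ext b)

lemma ext_inj (b : Wd → Fin 7) : Function.Injective (ext b) := by
  rintro ⟨w, a⟩ ⟨v, c⟩ h
  simp only [ext] at h
  have h1 := (List.append_inj' h rfl).1
  have h2 := List.append_inj' h1 rfl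
  simp only [List.cons.injEq, and_true] at h2
  rw [h2.1, h2.2]

lemma card_cand (b : Wd → Fin 7) (S : Finset Wd) : (cand b S).card = 7 * S.card := by
  classical
  rw [cand, Finset.card_image_of_injective _ (ext_inj b), Finset.card_product]
  simp [mul_comm]

def Rep (n : ℕ) (w : Wd) : Prop := 1 ≤ n ∧ w[2 * n]? = w[2 * n - 2]?

def Bad (n : ℕ) (w : Wd) : Prop :=
  Rep n w ∨ ∃ p, 3 ≤ p ∧ (SqEnd w (2 * n + 1) p ∨ SqEnd w (2 * n + 2) p)

open Classical in
noncomputable def S (b : Wd → Fin 7) : ℕ → Finset Wd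
  | 0 => {[]}
  | n + 1 => (cand b (S b n)).filter (fun w => ¬ Bad n w)

lemma mem_cand {b : Wd → Fin 7} {T : Finset Wd} {n : ℕ} (hT : ∀ w ∈ T, w.length = 2 * n)
    {w : Wd} (h : w ∈ cand b T) : w.length = 2 * n + 2 ∧ w.take (2 * n) ∈ T ∧
      w[2 * n + 1]? = some (b (w.take (2 * n + 1))) := by
  classical
  simp only [cand, Finset.mem_image, Finset.mem_product, Finset.mem_univ, and_true] at h
  obtain ⟨⟨v, a⟩, hv, rfl⟩ := h
  simp only at hv
  have hl := hT v hv
  refine ⟨by simp [ext, hl], ?_, ?_⟩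
  · simp only [ext, List.append_assoc]
    rw [← hl, List.take_left]
    exact hv
  · have hl' : (v ++ [a]).length = 2 * n + 1 := by simp [hl]
    simp only [ext]
    rw [← hl', List.take_left, List.getElem?_append_right le_rfl]
    simp

lemma S_length (b : Wd → Fin 7) (n : ℕ) : ∀ w ∈ S b n, w.length = 2 * n := by
  classical
  induction n with
  | zero => intro w hw; simp [S] at hw; simp [hw]
  | succ n ih =>
    intro w hw
    simp only [S, Finset.mem_filter] at hw
    have := (mem_cand ih hw.1).1
    omega

lemma S_succ {b : Wd → Fin 7} {n : ℕ} {w : Wd} (h : w ∈ S b (n + 1)) :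
    w ∈ cand b (S b n) ∧ ¬ Bad n w := by
  classical
  simpa only [S, Finset.mem_filter] using h

lemma S_take {b : Wd → Fin 7} {m n : ℕ} (hmn : m ≤ n) : ∀ w ∈ S b n, w.take (2 * m) ∈ S b m := by
  induction n, hmn using Nat.le_induction with
  | base =>
    intro w hw
    rw [List.take_of_length_le (by rw [S_length b m w hw])]
    exact hw
  | succ n hmn ih =>
    intro w hw
    have := ih _ (mem_cand (S_length b n) (S_succ hw).1).2.1
    rwa [List.take_take, min_eq_left (by omega)] at this

lemma S_cons {b : Wd → Fin 7} {n : ℕ} : ∀ w ∈ S b n, ∀ k < n,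
    w[2 * k + 1]? = some (b (w.take (2 * k + 1))) := by
  intro w hw k hk
  have h1 := S_take (m := k + 1) hk w hw
  have h2 := (mem_cand (S_length b k) (S_succ h1).1).2.2
  rwa [List.take_take, min_eq_left (by omega), List.getElem?_take_of_lt (by omega)] at h2

lemma S_rep {b : Wd → Fin 7} {n : ℕ} : ∀ w ∈ S b n, ∀ k, 1 ≤ k → k < n →
    w[2 * k]? ≠ w[2 * k - 2]? := by
  intro w hw k hk1 hk h
  have h1 := S_take (m := k + 1) hk w hw
  apply (S_succ h1).2
  left
  refine ⟨hk1, ?_⟩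
  rwa [List.getElem?_take_of_lt (by omega), List.getElem?_take_of_lt (by omega)]

lemma S_good {b : Wd → Fin 7} {n : ℕ} : ∀ w ∈ S b n, Good w := by
  intro w hw L p hp hs
  have hl := S_length b n w hw
  obtain ⟨h1, h2, h3⟩ := id hs
  rcases Nat.lt_or_ge p 3 with hp3 | hp3
  · obtain rfl : p = 2 := by omega
    rcases Nat.even_or_odd' L with ⟨k, rfl | rfl⟩
    · apply S_rep w hw (k - 1) (by omega) (by omega)
      have := h3 0 (by omega)
      convert this using 2 <;> omega
    · apply S_rep w hw k (by omega) (by omega)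
      have := h3 1 (by omega)
      convert this using 2 <;> omega
  · obtain ⟨k, hk⟩ : ∃ k, L = 2 * k + 1 ∨ L = 2 * k + 2 := ⟨(L - 1) / 2, by omega⟩
    have h1 := S_take (m := k + 1) (by omega) w hw
    apply (S_succ h1).2
    right
    refine ⟨p, hp3, ?_⟩
    rcases hk with rfl | rfl
    · left; exact hs.take (by omega)
    · right; exact hs.take (by omega)

lemma cand_ext {b : Wd → Fin 7} {n L : ℕ} {w v : Wd} (hw : w ∈ cand b (S b n))
    (hv : v ∈ cand b (S b n)) (hL : 2 * n + 1 ≤ L) (h : w.take L = v.take L) : w = v := by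
  obtain ⟨a1, _, a3⟩ := mem_cand (S_length b n) hw
  obtain ⟨b1, _, b3⟩ := mem_cand (S_length b n) hv
  have h' : w.take (2 * n + 1) = v.take (2 * n + 1) := by
    have := congrArg (List.take (2 * n + 1)) h
    rwa [List.take_take, List.take_take, min_eq_left hL] at this
  apply List.ext_getElem?
  intro i
  rcases Nat.lt_trichotomy i (2 * n + 1) with hi | rfl | hi
  · rw [← List.getElem?_take_of_lt hi, h', List.getElem?_take_of_lt hi]
  · rw [a3, b3, h']
  · rw [List.getElem?_eq_none (by omega), List.getElem?_eq_none (by omega)]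

open Classical in
lemma card_rep (b : Wd → Fin 7) (n : ℕ) :
    ((cand b (S b n)).filter (Rep n)).card ≤ (S b n).card := by
  apply Finset.card_le_card_of_injOn (fun w => w.take (2 * n))
  · intro w hw
    simp only [Finset.coe_filter, Set.mem_ofPred_eq] at hw
    exact (mem_cand (S_length b n) hw.1).2.1
  · intro w hw v hv h
    simp only [Finset.coe_filter, Set.mem_ofPred_eq] at hw hv
    simp only at h
    obtain ⟨hw, hn, hw2⟩ := hw
    obtain ⟨hv, _, hv2⟩ := hv
    have key : ∀ i, i < 2 * n → w[i]? = v[i]? := fun i hi => by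
      rw [← List.getElem?_take_of_lt hi, h, List.getElem?_take_of_lt hi]
    apply cand_ext hw hv le_rfl
    rw [List.take_add_one, List.take_add_one, h, hw2, hv2, key _ (by omega)]

open Classical in
lemma card_sq (b : Wd → Fin 7) (n L p m : ℕ) (hL : 2 * n + 1 ≤ L) (hm : m ≤ n)
    (hp : L - p ≤ 2 * m) :
    ((cand b (S b n)).filter (fun w => SqEnd w L p)).card ≤ (S b m).card := by
  apply Finset.card_le_card_of_injOn (fun w => w.take (2 * m))
  · intro w hw
    simp only [Finset.coe_filter, Set.mem_ofPred_eq] at hw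
    have := S_take hm _ (mem_cand (S_length b n) hw.1).2.1
    rwa [List.take_take, min_eq_left (by omega)] at this
  · intro w hw v hv h
    simp only [Finset.coe_filter, Set.mem_ofPred_eq] at hw hv
    exact cand_ext hw.1 hv.1 hL (sqEnd_det hw.2 hv.2 hp h)

open Classical in
lemma card_bad (b : Wd → Fin 7) (n : ℕ) :
    ((cand b (S b n)).filter (Bad n)).card ≤
      2 * (S b n).card + 4 * ∑ m ∈ Finset.range n, (S b m).card := by
  set C := cand b (S b n) with hC
  let Q : ℕ → ℕ → Finset Wd := fun L p => C.filter (fun w => SqEnd w L p)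
  let R : ℕ → Finset Wd := fun m =>
    (Q (2 * n + 1) (2 * (n - m) + 1) ∪ Q (2 * n + 1) (2 * (n - m) + 2)) ∪
    (Q (2 * n + 2) (2 * (n - m) + 2) ∪ Q (2 * n + 2) (2 * (n - m) + 3))
  have hsub : C.filter (Bad n) ⊆
      (C.filter (Rep n) ∪ Q (2 * n + 2) 3) ∪ (Finset.range n).biUnion R := by
    intro w hw
    rw [Finset.mem_filter] at hw
    obtain ⟨hw, hb⟩ := hw
    simp only [Finset.mem_union, Finset.mem_biUnion, Finset.mem_range, Finset.mem_filter, Q, R]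
    rcases hb with hb | ⟨p, hp, hb | hb⟩
    · exact Or.inl (Or.inl ⟨hw, hb⟩)
    · right
      have := hb.1
      refine ⟨n - (p - 1) / 2, by omega, Or.inl ?_⟩
      rcases Nat.even_or_odd' p with ⟨k, hk | hk⟩
      · right
        rw [show 2 * (n - (n - (p - 1) / 2)) + 2 = p by omega]
        exact ⟨hw, hb⟩
      · left
        rw [show 2 * (n - (n - (p - 1) / 2)) + 1 = p by omega]
        exact ⟨hw, hb⟩
    · have := hb.1
      by_cases h3 : p = 3
      · subst h3
        exact Or.inl (Or.inr ⟨hw, hb⟩)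
      right
      refine ⟨n - (p - 2) / 2, by omega, Or.inr ?_⟩
      rcases Nat.even_or_odd' p with ⟨k, hk | hk⟩
      · left
        rw [show 2 * (n - (n - (p - 2) / 2)) + 2 = p by omega]
        exact ⟨hw, hb⟩
      · right
        rw [show 2 * (n - (n - (p - 2) / 2)) + 3 = p by omega]
        exact ⟨hw, hb⟩
  have hR : ((Finset.range n).biUnion R).card ≤ ∑ m ∈ Finset.range n, 4 * (S b m).card := by
    refine Finset.card_biUnion_le.trans (Finset.sum_le_sum fun m hm => ?_)
    rw [Finset.mem_range] at hm
    have q1 := card_sq b n (2 * n + 1) (2 * (n - m) + 1) m (by omega) (by omega) (by omega)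
    have q2 := card_sq b n (2 * n + 1) (2 * (n - m) + 2) m (by omega) (by omega) (by omega)
    have q3 := card_sq b n (2 * n + 2) (2 * (n - m) + 2) m (by omega) (by omega) (by omega)
    have q4 := card_sq b n (2 * n + 2) (2 * (n - m) + 3) m (by omega) (by omega) (by omega)
    have u1 := Finset.card_union_le
      (Q (2 * n + 1) (2 * (n - m) + 1) ∪ Q (2 * n + 1) (2 * (n - m) + 2))
      (Q (2 * n + 2) (2 * (n - m) + 2) ∪ Q (2 * n + 2) (2 * (n - m) + 3))
    have u2 := Finset.card_union_le
      (Q (2 * n + 1) (2 * (n - m) + 1)) (Q (2 * n + 1) (2 * (n - m) + 2))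
    have u3 := Finset.card_union_le
      (Q (2 * n + 2) (2 * (n - m) + 2)) (Q (2 * n + 2) (2 * (n - m) + 3))
    rw [← hC] at q1 q2 q3 q4
    simp only [R]
    simp only [Q] at *
    omega
  have t1 := Finset.card_le_card hsub
  have t2 := Finset.card_union_le (C.filter (Rep n) ∪ Q (2 * n + 2) 3) ((Finset.range n).biUnion R)
  have t3 := Finset.card_union_le (C.filter (Rep n)) (Q (2 * n + 2) 3)
  have t4 := card_rep b n
  have t5 := card_sq b n (2 * n + 2) 3 n (by omega) le_rfl (by omega)
  rw [← Finset.mul_sum] at hR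
  rw [← hC] at t4 t5
  simp only [Q] at *
  omega

lemma card_step (b : Wd → Fin 7) (n : ℕ) :
    7 * (S b n).card ≤ (S b (n + 1)).card +
      (2 * (S b n).card + 4 * ∑ m ∈ Finset.range n, (S b m).card) := by
  classical
  have h1 := card_bad b n
  have h2 := Finset.card_filter_add_card_filter_not (s := cand b (S b n)) (Bad n)
  rw [card_cand] at h2
  have h3 : (S b (n + 1)).card = ((cand b (S b n)).filter (fun w => ¬ Bad n w)).card := by
    simp only [S]
  have h4 : ((cand b (S b n)).filter (Bad n)).card ≤
      2 * (S b n).card + 4 * ∑ m ∈ Finset.range n, (S b m).card := by convert h1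
  have h5 : ((cand b (S b n)).filter (fun w => ¬ Bad n w)).card = (S b (n + 1)).card := by
    rw [h3]
  omega

lemma card_S (b : Wd → Fin 7) (n : ℕ) :
    1 ≤ (S b n).card ∧ 2 * ∑ m ∈ Finset.range n, (S b m).card ≤ (S b n).card := by
  induction n with
  | zero => simp [S]
  | succ n ih =>
    have := card_step b n
    rw [Finset.sum_range_succ]
    omega

/-- Ann can survive `n` more moves from `w`. -/
def W : ℕ → Wd → Prop
  | 0, w => Good w
  | n + 1, w => Good w ∧
      ((w.length % 2 = 0 → ∃ a, W n (w ++ [a])) ∧ (w.length % 2 = 1 → ∀ c, W n (w ++ [c])))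

lemma W_good {n : ℕ} {w : Wd} (h : W n w) : Good w := by
  cases n with
  | zero => exact h
  | succ n => exact h.1

lemma W_anti {n : ℕ} : ∀ {w : Wd}, W (n + 1) w → W n w := by
  induction n with
  | zero => intro w h; exact h.1
  | succ n ih =>
    intro w h
    refine ⟨h.1, fun he => ?_, fun ho c => ih (h.2.2 ho c)⟩
    obtain ⟨a, ha⟩ := h.2.1 he
    exact ⟨a, ih ha⟩

lemma W_mono {m n : ℕ} (hmn : m ≤ n) {w : Wd} (h : W n w) : W m w := by
  induction n, hmn using Nat.le_induction with
  | base => exact h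
  | succ n _ ih => exact ih (W_anti h)

lemma W_nil (N : ℕ) : W N [] := by
  classical
  by_contra hN
  let b : Wd → Fin 7 := fun w =>
    if h : ∃ c, ¬ W (N - (w.length + 1)) (w ++ [c]) then h.choose else 0
  have hb : ∀ w : Wd, (∃ c, ¬ W (N - (w.length + 1)) (w ++ [c])) →
      ¬ W (N - (w.length + 1)) (w ++ [b w]) := by
    intro w h
    simp only [b, dif_pos h]
    exact h.choose_spec
  obtain ⟨w, hw⟩ := Finset.card_pos.1 (card_S b N).1
  have hg := S_good w hw
  have hl := S_length b N w hw
  have key : ∀ k ≤ N, ¬ W (N - k) (w.take k) := by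
    intro k
    induction k with
    | zero => intro _; simpa using hN
    | succ k ih =>
      intro hk
      have hlk : (w.take k).length = k := by simp; omega
      have ih := ih (by omega)
      rw [show N - k = (N - (k + 1)) + 1 by omega] at ih
      have hkl : k < w.length := by omega
      have ht : w.take (k + 1) = w.take k ++ [w[k]] := by simp
      rw [ht]
      rcases Nat.mod_two_eq_zero_or_one k with h0 | h0
      · intro hW
        apply ih
        refine ⟨hg.take k, fun _ => ⟨_, hW⟩, fun h => ?_⟩
        rw [hlk] at h; omega
      · have hc := S_cons w hw (k / 2) (by omega)
        rw [show 2 * (k / 2) + 1 = k by omega, List.getElem?_eq_getElem hkl] at hc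
        rw [Option.some.inj hc]
        have := hb (w.take k)
        rw [hlk] at this
        apply this
        by_contra hno
        push Not at hno
        apply ih
        refine ⟨hg.take k, fun h => ?_, fun _ => hno⟩
        rw [hlk] at h; omega
  have := key N le_rfl
  rw [Nat.sub_self] at this
  exact this (hg.take N)

lemma win_step {w : Wd} (h : ∀ n, W n w) (he : w.length % 2 = 0) :
    ∃ a, ∀ n, W n (w ++ [a]) := by
  by_contra hno
  push Not at hno
  choose f hf using hno
  obtain ⟨a, ha⟩ := (h (Finset.univ.sup f + 1)).2.1 he
  exact hf a (W_mono (Finset.le_sup (Finset.mem_univ a)) ha)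

end NRG

/-- There is a strategy for Ann (moving first) that wins the non-repetitive
game of any length over a 7-letter alphabet: the produced word never contains
a non-trivial square `u ++ u` with `u.length ≥ 2` as a factor. -/
theorem ann_wins_nonrepetitive_game_seven_letters_ann_first :
    ∃ s : List (Fin 7) → Fin 7, ∀ b : List (Fin 7) → Fin 7, ∀ n : ℕ,
      ¬ ∃ u : List (Fin 7), 2 ≤ u.length ∧
          ∃ p q : List (Fin 7), gameWordAnnFirst s b n = p ++ (u ++ u) ++ q := by
    classical
  let s : List (Fin 7) → Fin 7 := fun w =>
    if h : ∃ a, ∀ n, NRG.W n (w ++ [a]) then h.choose else 0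
  have hs : ∀ w : List (Fin 7), (∃ a, ∀ n, NRG.W n (w ++ [a])) →
      ∀ n, NRG.W n (w ++ [s w]) := by
    intro w h
    simp only [s, dif_pos h]
    exact h.choose_spec
  refine ⟨s, fun b n => ?_⟩
  have key : ∀ k, (gameWordAnnFirst s b k).length = k ∧
      ∀ n, NRG.W n (gameWordAnnFirst s b k) := by
    intro k
    induction k with
    | zero => exact ⟨rfl, NRG.W_nil⟩
    | succ k ih =>
      obtain ⟨hl, hW⟩ := ih
      refine ⟨by simp [gameWordAnnFirst, hl], ?_⟩
      simp only [gameWordAnnFirst]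
      split_ifs with h0
      · exact hs _ (NRG.win_step hW (by rw [hl]; exact h0))
      · intro n
        exact (hW (n + 1)).2.2 (by rw [hl]; omega) _
  rintro ⟨u, hu, p, q, h⟩
  have hg := NRG.W_good ((key n).2 0)
  rw [h] at hg
  exact hg _ _ hu (NRG.sqEnd_of_factor u p q)
end

section
/- Let α be a type and x : List α a word of odd length n ≥ 1. Suppose that in the square x ++ x every letter at an odd index differs from its predecessor, i.e., for every odd index j with 1 ≤ j < 2 * n, (x ++ x).get j ≠ (x ++ x).get (j - 1). Then all cyclically adjacent letters of x are distinct: x.get k ≠ x.get (k+1) for every k with k + 1 < n, and x.get (n-1) ≠ x.get 0. -/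
/-- If `x` has odd length `n ≥ 1` and in the square `x ++ x` every letter at an
odd index differs from its predecessor, then all cyclically adjacent letters of
`x` are distinct. -/
theorem cyclic_adjacent_distinct_of_odd_square {α : Type*} (x : List α)
    (hx : Odd x.length)
    (h : ∀ j : ℕ, Odd j → 1 ≤ j → ∀ hj : j < 2 * x.length,
        (x ++ x)[j]'(by simp only [List.length_append]; omega) ≠
          (x ++ x)[j - 1]'(by simp only [List.length_append]; omega)) :
    (∀ k : ℕ, (hk : k + 1 < x.length) →
        x[k]'(by omega) ≠ x[k + 1]'hk) ∧
      x[x.length - 1]'(by rcases hx with ⟨m, hm⟩; omega) ≠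
        x[0]'(by rcases hx with ⟨m, hm⟩; omega) := by
  have hpos : 0 < x.length := hx.pos
  refine ⟨fun k hk heq => ?_, fun heq => ?_⟩
  · rcases Nat.even_or_odd k with he | ho
    · refine h (k + 1) he.add_one (by omega) (by omega) ?_
      rw [List.getElem_append_left hk, List.getElem_append_left (by omega)]
      simpa using heq.symm
    · refine h (x.length + k + 1) (hx.add_odd ho).add_one (by omega) (by omega) ?_
      rw [List.getElem_append_right (by omega), List.getElem_append_right (by omega)]
      have e1 : x.length + k + 1 - x.length = k + 1 := by omega
      have e2 : x.length + k + 1 - 1 - x.length = k := by omega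
      simp only [e1, e2]
      exact heq.symm
  · refine h x.length hx hpos (by omega) ?_
    rw [List.getElem_append_right (by omega), List.getElem_append_left (by omega)]
    simp only [Nat.sub_self]
    exact heq.symm
end
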